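/- In the multi-server secure aggregation model with heterogeneous security constraints, let u' ∈ [U], m ∈ [M], n ∈ [N] be such that 𝒮_m ∩ 𝒯_n = ∅ and |(𝒮_m ∩ 𝒦_{{u'}}) ∪ 𝒦_{𝒰^{(m,n)}} ∪ 𝒯_n| ≤ K−1. Then every scheme satisfies H(Z_Σ) ≥ (|((𝒮_m ∩ 𝒦_{{u'}}) ∪ 𝒯_n) ∩ 𝒮̄| + |𝒰^{(m,n)} ∖ {u'}|)·L. -/

import Mathlib

open Finset

open scoped Classical

noncomputable section

/-- Probability that the random variable `X` takes the value `s`, under the weights `μ`. -/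
def prb {Ω : Type} [Fintype Ω] (μ : Ω → ℝ) {α : Type} (X : Ω → α) (s : α) : ℝ :=
  ∑ ω ∈ Finset.univ.filter fun ω => X ω = s, μ ω

/-- Shannon entropy of `X` in `q`-ary units. -/
def ent (q : ℕ) {Ω : Type} [Fintype Ω] (μ : Ω → ℝ) {α : Type} [Fintype α] (X : Ω → α) : ℝ :=
  -∑ s : α, prb μ X s * Real.logb q (prb μ X s)

/-- Conditional entropy `H(X | Y)` in `q`-ary units. -/
def condEnt (q : ℕ) {Ω : Type} [Fintype Ω] (μ : Ω → ℝ) {α β : Type} [Fintype α] [Fintype β]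
    (X : Ω → α) (Y : Ω → β) : ℝ :=
  ent q μ (fun ω => (X ω, Y ω)) - ent q μ Y

/-- Conditional mutual information `I(X ; Y ∣ Z)` in `q`-ary units. -/
def mutInfo (q : ℕ) {Ω : Type} [Fintype Ω] (μ : Ω → ℝ) {α β γ : Type}
    [Fintype α] [Fintype β] [Fintype γ] (X : Ω → α) (Y : Ω → β) (Z : Ω → γ) : ℝ :=
  condEnt q μ X Z - condEnt q μ X fun ω => (Y ω, Z ω)

/-- The joint random variable formed by the members of a family of random variables
indexed by a finset. -/
def restr {Ω ι α : Type} (Z : ι → Ω → α) (T : Finset ι) : Ω → { i // i ∈ T } → α :=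
  fun ω i => Z i.1 ω

/-- The set of users `𝒦`: user `⟨u,v⟩` is the `v`-th user of server `u`. -/
abbrev Usr (U : ℕ) (V : Fin U → ℕ) : Type := Σ u : Fin U, Fin (V u)

/-- Total number of users, `K = ∑ u, V u`. -/
def Ktot (U : ℕ) (V : Fin U → ℕ) : ℕ := ∑ u, V u

/-- The users connected to server `u`, `𝒦_{{u}}`. -/
def Ksrv (U : ℕ) (V : Fin U → ℕ) (u : Fin U) : Finset (Usr U V) :=
  Finset.univ.filter fun i => i.1 = u

/-- The users connected to a set of servers, `𝒦_𝒰`. -/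
def KsrvSet (U : ℕ) (V : Fin U → ℕ) (A : Finset (Fin U)) : Finset (Usr U V) :=
  Finset.univ.filter fun i => i.1 ∈ A

/-- The set of servers `𝒰^{(m,n)}` associated with a security input set `Sm` and a
colluding set `Tn`. -/
def UServers (U : ℕ) (V : Fin U → ℕ) (Sm Tn : Finset (Usr U V)) : Finset (Fin U) :=
  Finset.univ.filter fun u =>
    (Sm ∩ Ksrv U V u).Nonempty ∧ ((Sm ∪ Tn) ∩ Ksrv U V u).card = V u

/-- The set `(𝒮_m ∩ 𝒦_{{u}}) ∪ 𝒦_{𝒰^{(m,n)}} ∪ 𝒯_n`. -/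
def BigB (U : ℕ) (V : Fin U → ℕ) (Sm Tn : Finset (Usr U V)) (u : Fin U) : Finset (Usr U V) :=
  (Sm ∩ Ksrv U V u) ∪ KsrvSet U V (UServers U V Sm Tn) ∪ Tn

/-- The implicit security input set `𝒮_I`. -/
def SImp (U : ℕ) (V : Fin U → ℕ) {M N : ℕ} (S : Fin M → Finset (Usr U V))
    (T : Fin N → Finset (Usr U V)) : Finset (Usr U V) :=
  Finset.univ.filter fun i =>
    (∀ m, i ∉ S m) ∧
    ∃ u m n, (BigB U V (S m) (T n) u).card = Ktot U V - 1 ∧ i ∉ BigB U V (S m) (T n) u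

/-- The total security input set `𝒮̄`. -/
def Sbar (U : ℕ) (V : Fin U → ℕ) {M N : ℕ} (S : Fin M → Finset (Usr U V))
    (T : Fin N → Finset (Usr U V)) : Finset (Usr U V) :=
  (Finset.univ.biUnion fun m => S m) ∪ SImp U V S T

/-- The set `𝒜_{u,m,n}`. -/
def Aset (U : ℕ) (V : Fin U → ℕ) {M N : ℕ} (S : Fin M → Finset (Usr U V))
    (T : Fin N → Finset (Usr U V)) (u : Fin U) (m : Fin M) (n : Fin N) : Finset (Usr U V) :=
  BigB U V (S m) (T n) u ∩ Sbar U V S T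

/-- `a* = max_{u,m,n} |𝒜_{u,m,n}|`. -/
def aStar (U : ℕ) (V : Fin U → ℕ) {M N : ℕ} (S : Fin M → Finset (Usr U V))
    (T : Fin N → Finset (Usr U V)) : ℕ :=
  Finset.univ.sup fun t : Fin U × Fin M × Fin N => (Aset U V S T t.1 t.2.1 t.2.2).card

/-- `|((𝒮_m ∩ 𝒦_{{u}}) ∪ 𝒯_n) ∩ 𝒮̄| + |𝒰^{(m,n)} ∖ {u}|`. -/
def eVal (U : ℕ) (V : Fin U → ℕ) {M N : ℕ} (S : Fin M → Finset (Usr U V))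
    (T : Fin N → Finset (Usr U V)) (u : Fin U) (m : Fin M) (n : Fin N) : ℕ :=
  (((S m ∩ Ksrv U V u) ∪ T n) ∩ Sbar U V S T).card + ((UServers U V (S m) (T n)).erase u).card

/-- `e* = max_{u,m,n} (|((𝒮_m ∩ 𝒦_{{u}}) ∪ 𝒯_n) ∩ 𝒮̄| + |𝒰^{(m,n)} ∖ {u}|)`. -/
def eStar (U : ℕ) (V : Fin U → ℕ) {M N : ℕ} (S : Fin M → Finset (Usr U V))
    (T : Fin N → Finset (Usr U V)) : ℕ :=
  Finset.univ.sup fun t : Fin U × Fin M × Fin N => eVal U V S T t.1 t.2.1 t.2.2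

/-- The set `𝒬_1`. -/
def Q1set (U : ℕ) (V : Fin U → ℕ) {M N : ℕ} (S : Fin M → Finset (Usr U V))
    (T : Fin N → Finset (Usr U V)) : Finset (Usr U V) :=
  (Finset.univ.filter fun t : Fin U × Fin M × Fin N =>
      (Aset U V S T t.1 t.2.1 t.2.2).card = (Sbar U V S T).card).biUnion
    fun t => BigB U V (S t.2.1) (T t.2.2) t.1

/-- The set `𝒬_2`. -/
def Q2set (U : ℕ) (V : Fin U → ℕ) {M N : ℕ} (S : Fin M → Finset (Usr U V))
    (T : Fin N → Finset (Usr U V)) : Finset (Usr U V) :=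
  (Finset.univ.filter fun t : Fin U × Fin M × Fin N =>
      eVal U V S T t.1 t.2.1 t.2.2 = eStar U V S T).biUnion
    fun t => BigB U V (S t.2.1) (T t.2.2) t.1

/-- The set `𝒬`. -/
def Qset (U : ℕ) (V : Fin U → ℕ) {M N : ℕ} (S : Fin M → Finset (Usr U V))
    (T : Fin N → Finset (Usr U V)) : Finset (Usr U V) :=
  if (Q1set U V S T).Nonempty then Q1set U V S T ∪ Q2set U V S T else ∅

/-- A secure-aggregation scheme: all structural, distributional, correctness and
security constraints of the multi-server secure aggregation model, with entropies in
`q`-ary units for `q = |F|`. -/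
def IsScheme (U : ℕ) (V : Fin U → ℕ) (M N : ℕ) (S : Fin M → Finset (Usr U V))
    (T : Fin N → Finset (Usr U V)) (F : Type) [Field F] [Fintype F]
    (Ω : Type) [Fintype Ω] (μ : Ω → ℝ) (L LX LY LZ LSig : ℕ)
    (W : Usr U V → Ω → Fin L → F) (Z : Usr U V → Ω → Fin LZ → F)
    (X : Usr U V → Ω → Fin LX → F) (Y : Fin U → Ω → Fin LY → F)
    (ZS : Ω → Fin LSig → F) : Prop :=
  let q := Fintype.card F
  (1 ≤ L) ∧
  (∀ ω, 0 ≤ μ ω) ∧ (∑ ω, μ ω = 1) ∧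
  -- each input consists of `L` i.i.d. uniform `q`-ary symbols
  (∀ i, ent q μ (W i) = L) ∧
  -- the inputs are mutually independent of each other and of all keys
  (ent q μ (fun ω => (restr W Finset.univ ω, restr Z Finset.univ ω)) =
    ent q μ (restr Z Finset.univ) + ∑ i, ent q μ (W i)) ∧
  -- the source key consists of `LSig` i.i.d. uniform `q`-ary symbols
  (ent q μ ZS = LSig) ∧
  -- the individual keys are deterministic functions of the source key
  (condEnt q μ (restr Z Finset.univ) ZS = 0) ∧
  -- each user message is a deterministic function of its input and key
  (∀ i, condEnt q μ (X i) (fun ω => (W i ω, Z i ω)) = 0) ∧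
  -- each server message is a deterministic function of its received messages
  (∀ u, condEnt q μ (Y u) (restr X (Ksrv U V u)) = 0) ∧
  -- correctness
  (∀ k, condEnt q μ (fun ω => ∑ i, W i ω)
    (fun ω => (restr Y (Finset.univ.erase k) ω, restr X (Ksrv U V k) ω)) = 0) ∧
  -- security
  (∀ k m n, mutInfo q μ
    (fun ω => (restr Y (Finset.univ.erase k) ω, restr X (Ksrv U V k) ω))
    (restr W (S m))
    (fun ω => (∑ i, W i ω, restr W (T n) ω, restr Z (T n) ω)) = 0)

/-- A rate tuple `(R_X, R_Y, R_{Z_Σ})` is achievable. -/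
def Achievable (U : ℕ) (V : Fin U → ℕ) (M N : ℕ) (S : Fin M → Finset (Usr U V))
    (T : Fin N → Finset (Usr U V)) (R : ℝ × ℝ × ℝ) : Prop :=
  ∃ (F : Type) (iF : Field F) (iFt : Fintype F) (Ω : Type) (iΩ : Fintype Ω)
    (μ : Ω → ℝ) (L LX LY LZ LSig : ℕ)
    (W : Usr U V → Ω → Fin L → F) (Z : Usr U V → Ω → Fin LZ → F)
    (X : Usr U V → Ω → Fin LX → F) (Y : Fin U → Ω → Fin LY → F)
    (ZS : Ω → Fin LSig → F),
    R.1 = (LX : ℝ) / (L : ℝ) ∧ R.2.1 = (LY : ℝ) / (L : ℝ) ∧ R.2.2 = (LSig : ℝ) / (L : ℝ) ∧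
    @IsScheme U V M N S T F iF iFt Ω iΩ μ L LX LY LZ LSig W Z X Y ZS

end

/-! ### Polymatroids and functional dependence -/

/-- A normalized, monotone, submodular set function. -/
structure IsPolymatroid {J : Type} (h : Set J → ℝ) : Prop where
  empty : h ∅ = 0
  mono : ∀ {A B : Set J}, A ⊆ B → h A ≤ h B
  submod : ∀ {A B C : Set J}, C ⊆ A → C ⊆ B → h (A ∪ B) + h C ≤ h A + h B

/-- The variables in `B` are (almost surely) functions of those in `A`. -/
def Determines {J : Type} (h : Set J → ℝ) (A B : Set J) : Prop :=
  h (A ∪ B) ≤ h A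

namespace IsPolymatroid

variable {J : Type} {h : Set J → ℝ} {A A' B C : Set J}

theorem determines_of_subset (hBA : B ⊆ A) : Determines h A B := by
  simp [Determines, Set.union_eq_left.2 hBA]

theorem determines_mono (hp : IsPolymatroid h) (hd : Determines h A B) (hA : A ⊆ A') :
    Determines h A' B := by
  have h1 := hp.submod (A := A') (B := A ∪ B) (C := A) hA Set.subset_union_left
  have h2 : A' ∪ (A ∪ B) = A' ∪ B := by
    rw [← Set.union_assoc, Set.union_eq_left.2 hA]
  unfold Determines at *
  rw [h2] at h1
  linarith

theorem determines_union (hp : IsPolymatroid h) (hB : Determines h A B)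
    (hC : Determines h A C) : Determines h A (B ∪ C) := by
  have h1 := hp.submod (A := A ∪ B) (B := A ∪ C) (C := A)
    Set.subset_union_left Set.subset_union_left
  have h2 : A ∪ B ∪ (A ∪ C) = A ∪ (B ∪ C) := by
    ext; simp; tauto
  unfold Determines at *
  rw [h2] at h1
  linarith

theorem determines_anti (hp : IsPolymatroid h) (hB : Determines h A B) (hC : C ⊆ B) :
    Determines h A C :=
  (hp.mono (Set.union_subset_union_right A hC)).trans hB

theorem determines_trans (hp : IsPolymatroid h) (hB : Determines h A B)
    (hC : Determines h B C) : Determines h A C := by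
  have h1 : Determines h (A ∪ B) C := hp.determines_mono hC Set.subset_union_right
  have h2 : h (A ∪ C) ≤ h (A ∪ B ∪ C) :=
    hp.mono (Set.union_subset_union_left C Set.subset_union_left)
  exact h2.trans (h1.trans hB)

theorem determines_of_finite (hp : IsPolymatroid h) (hB : B.Finite)
    (hd : ∀ b ∈ B, Determines h A {b}) : Determines h A B := by
  induction B, hB using Set.Finite.induction_on with
  | empty => exact determines_of_subset (Set.empty_subset A)
  | @insert b B _ _ ih =>
    rw [Set.insert_eq]
    exact hp.determines_union (hd b (by simp)) (ih fun c hc => hd c (by simp [hc]))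

theorem le_of_determines (hp : IsPolymatroid h) (hd : Determines h A B) : h B ≤ h A :=
  (hp.mono Set.subset_union_right).trans hd

/-- Variables each carrying `L` units of information given some set which determines the
conditioning variables and all the other variables jointly carry `L` units apiece. -/
theorem add_card_mul_le (hp : IsPolymatroid h) (L : ℝ) (D : Set J) (I : Finset J)
    (hI : ∀ b ∈ I, ∃ R, D ⊆ R ∧ (∀ c ∈ I, c ≠ b → Determines h R {c}) ∧
      L + h R ≤ h ({b} ∪ R)) :
    h D + I.card * L ≤ h (↑I ∪ D) := by
  classical
  induction I using Finset.induction_on with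
  | empty => simp
  | @insert b I hb ih =>
    have ih' := ih fun c hc => by
      obtain ⟨R, hDR, hR, hg⟩ := hI c (Finset.mem_insert_of_mem hc)
      exact ⟨R, hDR, fun d hd => hR d (Finset.mem_insert_of_mem hd), hg⟩
    obtain ⟨R, hDR, hR, hg⟩ := hI b (Finset.mem_insert_self b I)
    have h1 := hp.submod (A := {b} ∪ ↑I ∪ D) (B := ↑I ∪ R) (C := ↑I ∪ D)
      (Set.union_subset_union_left D Set.subset_union_right)
      (Set.union_subset_union_right _ hDR)
    have h2 : Determines h R ↑I := hp.determines_of_finite I.finite_toSet fun c hc =>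
      hR c (Finset.mem_insert_of_mem hc) (by rintro rfl; exact hb hc)
    have h3 : h (↑I ∪ R) ≤ h R := by rw [Set.union_comm]; exact h2
    have h4 : h ({b} ∪ R) ≤ h ({b} ∪ ↑I ∪ D ∪ (↑I ∪ R)) := hp.mono (by
      intro v; simp only [Set.mem_union]; tauto)
    have h6 : (↑(insert b I) : Set J) = {b} ∪ ↑I := by rw [Finset.coe_insert, Set.insert_eq]
    rw [Finset.card_insert_of_notMem hb, h6]
    push_cast
    linarith

end IsPolymatroid

/-! ### Secure aggregation in terms of a polymatroid -/

/-- The random variables of an aggregation scheme: inputs, keys, user messages, server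
messages, the sum of the inputs and the source key. -/
inductive Var (U : ℕ) (V : Fin U → ℕ) : Type
  | w (i : Usr U V)
  | z (i : Usr U V)
  | x (i : Usr U V)
  | y (u : Fin U)
  | sum
  | source

namespace Var

variable {U : ℕ} {V : Fin U → ℕ}

/-- The inputs and keys of a set of users. -/
def wz (R : Set (Usr U V)) : Set (Var U V) := w '' R ∪ z '' R

/-- What server `k` sees: the messages of the other servers and of its own users. -/
def view (k : Fin U) : Set (Var U V) := y '' {u | u ≠ k} ∪ x '' {i | i.1 = k}

theorem wz_mono {R R' : Set (Usr U V)} (hR : R ⊆ R') : wz R ⊆ wz R' :=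
  Set.union_subset_union (Set.image_mono hR) (Set.image_mono hR)

end Var

open Var

/-- The entropic constraints satisfied by a secure aggregation scheme. -/
structure IsSecAgg {U : ℕ} {V : Fin U → ℕ} {M N : ℕ} (S : Fin M → Finset (Usr U V))
    (T : Fin N → Finset (Usr U V)) (L : ℝ) (h : Set (Var U V) → ℝ) : Prop where
  poly : IsPolymatroid h
  w_le : ∀ i, h {w i} ≤ L
  sum_le : h {sum} ≤ L
  indep : h (z '' Set.univ) + Fintype.card (Usr U V) * L ≤
    h (w '' Set.univ ∪ z '' Set.univ)
  det_z : Determines h {source} (z '' Set.univ)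
  det_x : ∀ i, Determines h {w i, z i} {x i}
  det_y : ∀ u, Determines h (x '' {i | i.1 = u}) {y u}
  det_w : ∀ j, Determines h ({sum} ∪ w '' {j}ᶜ) {w j}
  det_sum : ∀ k, Determines h (view k) {sum}
  secure : ∀ k m n, h (view k ∪ ({sum} ∪ wz ↑(T n))) + h (w '' ↑(S m) ∪ ({sum} ∪ wz ↑(T n))) ≤
    h (view k ∪ (w '' ↑(S m) ∪ ({sum} ∪ wz ↑(T n)))) + h ({sum} ∪ wz ↑(T n))

namespace IsSecAgg

variable {U : ℕ} {V : Fin U → ℕ} {M N : ℕ} {S : Fin M → Finset (Usr U V)}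
  {T : Fin N → Finset (Usr U V)} {L : ℝ} {h : Set (Var U V) → ℝ}

theorem w_union_z_le (hs : IsSecAgg S T L h) (R : Finset (Usr U V)) :
    h (w '' ↑R ∪ z '' Set.univ) ≤ h (z '' Set.univ) + R.card * L := by
  induction R using Finset.induction_on with
  | empty => simp
  | @insert i R hi ih =>
    have h1 := hs.poly.submod (A := {w i}) (B := w '' ↑R ∪ z '' Set.univ) (C := ∅)
      (by simp) (by simp)
    have h2 : {w i} ∪ (w '' ↑R ∪ z '' Set.univ) = w '' ↑(insert i R) ∪ z '' Set.univ := by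
      rw [Finset.coe_insert, Set.image_insert_eq, Set.insert_eq, Set.union_assoc]
    rw [h2, hs.poly.empty] at h1
    have h3 := hs.w_le i
    rw [Finset.card_insert_of_notMem hi]
    push_cast at h1 ⊢
    linarith

theorem compl_gain (hs : IsSecAgg S T L h) (j : Usr U V) :
    L + h (w '' {j}ᶜ ∪ z '' Set.univ) ≤ h (w '' Set.univ ∪ z '' Set.univ) := by
  have h1 := hs.w_union_z_le (Finset.univ.erase j)
  have h2 : ((Finset.univ.erase j).card : ℝ) = Fintype.card (Usr U V) - 1 := by
    have := Finset.card_erase_add_one (Finset.mem_univ j)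
    rw [Finset.card_univ] at this
    rw [← this]; push_cast; ring
  have h3 : (↑(Finset.univ.erase j) : Set (Usr U V)) = {j}ᶜ := by ext; simp
  rw [h2, h3] at h1
  have := hs.indep
  linarith

theorem w_gain (hs : IsSecAgg S T L h) (i : Usr U V) :
    L + h (wz {i}ᶜ) ≤ h ({w i} ∪ wz {i}ᶜ) := by
  have h1 := hs.poly.submod (A := {w i} ∪ wz {i}ᶜ) (B := w '' {i}ᶜ ∪ z '' Set.univ)
    (C := wz {i}ᶜ) Set.subset_union_right
    (Set.union_subset_union_right _ (Set.image_mono (Set.subset_univ _)))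
  have h2 := hs.compl_gain i
  have h3 : h (w '' Set.univ ∪ z '' Set.univ) ≤
      h ({w i} ∪ wz {i}ᶜ ∪ (w '' {i}ᶜ ∪ z '' Set.univ)) := hs.poly.mono (by
    rintro _ (⟨k, -, rfl⟩ | ⟨k, -, rfl⟩)
    · by_cases hk : k = i
      · simp [hk]
      · simp [hk]
    · simp)
  linarith

theorem sum_gain (hs : IsSecAgg S T L h) (j : Usr U V) :
    L + h (w '' {j}ᶜ ∪ z '' Set.univ) ≤ h ({sum} ∪ (w '' {j}ᶜ ∪ z '' Set.univ)) := by
  refine (hs.compl_gain j).trans (hs.poly.le_of_determines ?_)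
  have h1 : Determines h ({sum} ∪ (w '' {j}ᶜ ∪ z '' Set.univ)) {w j} :=
    hs.poly.determines_mono (hs.det_w j)
      (Set.union_subset_union_right _ Set.subset_union_left)
  refine hs.poly.determines_anti (hs.poly.determines_union
    (IsPolymatroid.determines_of_subset (le_refl ({sum} ∪ (w '' {j}ᶜ ∪ z '' Set.univ)))) h1) ?_
  rintro _ (⟨k, -, rfl⟩ | ⟨k, -, rfl⟩)
  · by_cases hk : k = j
    · simp [hk]
    · simp [hk]
  · simp

theorem wz_det_x (hs : IsSecAgg S T L h) {A : Set (Var U V)} {i : Usr U V}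
    (hw : w i ∈ A) (hz : z i ∈ A) : Determines h A {x i} :=
  hs.poly.determines_mono (hs.det_x i) (by
    rintro _ (rfl | rfl) <;> assumption)

theorem wz_det_y (hs : IsSecAgg S T L h) {A : Set (Var U V)} {u : Fin U}
    (hA : ∀ i : Usr U V, i.1 = u → w i ∈ A ∧ z i ∈ A) : Determines h A {y u} := by
  refine hs.poly.determines_trans (hs.poly.determines_of_finite (Set.toFinite _) ?_) (hs.det_y u)
  rintro _ ⟨i, hi, rfl⟩
  exact hs.wz_det_x (hA i hi).1 (hA i hi).2

/-- If a message together with the inputs and keys of all users but `i` determines the view of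
some server, then it carries `L` units of information beyond those inputs and keys. -/
theorem message_gain (hs : IsSecAgg S T L h) {k : Fin U} {i : Usr U V} {a : Var U V}
    (ha : ∀ b ∈ view k, b ≠ a → Determines h (wz {i}ᶜ) {b}) :
    L + h (wz {i}ᶜ) ≤ h ({a} ∪ wz {i}ᶜ) := by
  refine (hs.w_gain i).trans (hs.poly.le_of_determines ?_)
  have hsub : Determines h ({a} ∪ wz {i}ᶜ) (wz {i}ᶜ) :=
    IsPolymatroid.determines_of_subset Set.subset_union_right
  have hview : Determines h ({a} ∪ wz {i}ᶜ) (view k) := by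
    refine hs.poly.determines_of_finite (by unfold view; exact Set.toFinite _) fun b hb => ?_
    by_cases hba : b = a
    · exact IsPolymatroid.determines_of_subset (by simp [hba])
    · exact hs.poly.determines_trans hsub (ha b hb hba)
  have hw : Determines h ({a} ∪ wz {i}ᶜ) {w i} := by
    refine hs.poly.determines_trans (hs.poly.determines_union
      (hs.poly.determines_trans hview (hs.det_sum k)) ?_) (hs.det_w i)
    exact hs.poly.determines_anti hsub Set.subset_union_left
  exact hs.poly.determines_union hw hsub

theorem x_gain (hs : IsSecAgg S T L h) (i : Usr U V) :
    L + h (wz {i}ᶜ) ≤ h ({x i} ∪ wz {i}ᶜ) := by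
  refine hs.message_gain (k := i.1) ?_
  rintro _ (⟨u, hu, rfl⟩ | ⟨j, hj, rfl⟩) hne
  · refine hs.wz_det_y fun j hj => ?_
    have : j ≠ i := by rintro rfl; exact hu hj.symm
    simp [wz, this]
  · have : j ≠ i := by rintro rfl; exact hne rfl
    exact hs.wz_det_x (by simp [wz, this]) (by simp [wz, this])

theorem y_gain (hs : IsSecAgg S T L h) {k : Fin U} {i : Usr U V} (hk : i.1 ≠ k) :
    L + h (wz {i}ᶜ) ≤ h ({y i.1} ∪ wz {i}ᶜ) := by
  refine hs.message_gain (k := k) ?_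
  rintro _ (⟨u, hu, rfl⟩ | ⟨j, hj, rfl⟩) hne
  · refine hs.wz_det_y fun j hj => ?_
    have : j ≠ i := by rintro rfl; exact hne (by rw [hj])
    simp [wz, this]
  · have : j ≠ i := by rintro rfl; exact hk hj
    exact hs.wz_det_x (by simp [wz, this]) (by simp [wz, this])

theorem secure_of_subset (hs : IsSecAgg S T L h) {k : Fin U} (m : Fin M) (n : Fin N)
    {a : Set (Var U V)} (ha : a ⊆ view k) :
    h (a ∪ ({sum} ∪ wz ↑(T n))) + h (w '' ↑(S m) ∪ ({sum} ∪ wz ↑(T n))) ≤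
      h (a ∪ (w '' ↑(S m) ∪ ({sum} ∪ wz ↑(T n)))) + h ({sum} ∪ wz ↑(T n)) := by
  have h1 := hs.secure k m n
  generalize ({sum} ∪ wz ↑(T n) : Set (Var U V)) = C at *
  have h2 := hs.poly.submod (A := view k ∪ C) (B := a ∪ (w '' ↑(S m) ∪ C)) (C := a ∪ C)
    (Set.union_subset_union_left _ ha)
    (Set.union_subset_union_right _ Set.subset_union_right)
  have h3 : h (view k ∪ (w '' ↑(S m) ∪ C)) ≤ h (view k ∪ C ∪ (a ∪ (w '' ↑(S m) ∪ C))) :=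
    hs.poly.mono (by intro v; simp only [Set.mem_union]; tauto)
  linarith

/-- The keys must mask the messages `a` visible to a server: conditionally on the keys of the
colluding set, the keys of `P` carry at least the information in `a`. -/
theorem key_gain (hs : IsSecAgg S T L h) {k : Fin U} (m : Fin M) (n : Fin N)
    {a : Set (Var U V)} (ha : a ⊆ view k) (P : Set (Usr U V))
    (hdet : Determines h ({sum} ∪ w '' (↑(S m) ∪ ↑(T n)) ∪ z '' (P ∪ ↑(T n))) a)
    {j : Usr U V} (hj : j ∉ T n) (hdet' : Determines h (w '' {j}ᶜ ∪ z '' Set.univ) a) :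
    h (z '' ↑(T n)) + h (a ∪ wz ↑(T n)) ≤ h (z '' (P ∪ ↑(T n))) + h (wz ↑(T n)) := by
  have h1 := hs.secure_of_subset m n ha
  have h2 : h (a ∪ (w '' ↑(S m) ∪ ({sum} ∪ wz ↑(T n)))) ≤
      h ({sum} ∪ w '' (↑(S m) ∪ ↑(T n)) ∪ z '' (P ∪ ↑(T n))) := by
    refine hs.poly.le_of_determines (hs.poly.determines_union hdet
      (IsPolymatroid.determines_of_subset ?_))
    intro v
    simp only [wz, Set.image_union, Set.mem_union]
    tauto
  have h3 := hs.poly.submod (A := w '' ↑(S m) ∪ ({sum} ∪ wz ↑(T n)))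
    (B := z '' (P ∪ ↑(T n))) (C := z '' ↑(T n))
    (by intro v; simp only [wz, Set.mem_union]; tauto)
    (Set.image_mono Set.subset_union_right)
  have h4 : h ({sum} ∪ w '' (↑(S m) ∪ ↑(T n)) ∪ z '' (P ∪ ↑(T n))) ≤
      h (w '' ↑(S m) ∪ ({sum} ∪ wz ↑(T n)) ∪ z '' (P ∪ ↑(T n))) :=
    hs.poly.mono (by intro v; simp only [wz, Set.image_union, Set.mem_union]; tauto)
  have h5 := hs.poly.submod (A := {sum}) (B := wz ↑(T n)) (C := ∅) (by simp) (by simp)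
  have h6 := hs.sum_le
  have hT : wz ↑(T n) ⊆ w '' {j}ᶜ ∪ z '' Set.univ :=
    Set.union_subset_union (Set.image_mono (by
      intro i hi; simp only [Set.mem_compl_iff, Set.mem_singleton_iff]
      rintro rfl; exact hj (by simpa using hi))) (Set.image_mono (Set.subset_univ _))
  have h7 := hs.poly.submod (A := a ∪ ({sum} ∪ wz ↑(T n)))
    (B := w '' {j}ᶜ ∪ z '' Set.univ ∪ a) (C := a ∪ wz ↑(T n))
    (Set.union_subset_union_right _ Set.subset_union_right)
    (by rw [Set.union_comm a]; exact Set.union_subset_union_left _ hT)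
  have h8 : h ({sum} ∪ (w '' {j}ᶜ ∪ z '' Set.univ)) ≤
      h (a ∪ ({sum} ∪ wz ↑(T n)) ∪ (w '' {j}ᶜ ∪ z '' Set.univ ∪ a)) :=
    hs.poly.mono (by intro v; simp only [Set.mem_union]; tauto)
  have h9 := hs.sum_gain j
  have h10 : h (w '' {j}ᶜ ∪ z '' Set.univ ∪ a) ≤ h (w '' {j}ᶜ ∪ z '' Set.univ) := hdet'
  have h11 := hs.poly.empty
  linarith

/-- The keys of `R ∪ {i}` carry at least `L` units more than those of `R ⊆ 𝒯_n` whenever a single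
message, depending on the colluding set and user `i` only, has to be masked. -/
theorem key_insert_gain (hs : IsSecAgg S T L h) {k : Fin U} (m : Fin M) (n : Fin N)
    {i : Usr U V} {a : Var U V} (ha : a ∈ view k) (hi : i ∉ T n)
    (hdet : Determines h (wz (insert i ↑(T n))) {a})
    (hw : Determines h ({sum} ∪ w '' (↑(S m) ∪ ↑(T n))) {w i})
    {j : Usr U V} (hj : j ∉ T n) (hij : i ≠ j)
    (hgain : L + h (wz {i}ᶜ) ≤ h ({a} ∪ wz {i}ᶜ))
    {R : Set (Usr U V)} (hR : R ⊆ ↑(T n)) :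
    L + h (z '' R) ≤ h (z '' (insert i R)) := by
  have h1 := hs.key_gain m n (a := {a}) (by simpa using ha) {i} (by
    refine hs.poly.determines_trans ?_ hdet
    refine hs.poly.determines_anti (hs.poly.determines_union
      (IsPolymatroid.determines_of_subset subset_rfl)
      (hs.poly.determines_mono hw Set.subset_union_left)) ?_
    rintro _ (⟨l, hl, rfl⟩ | ⟨l, hl, rfl⟩) <;> simp at hl ⊢ <;> tauto) hj (by
    refine hs.poly.determines_mono hdet ?_
    rintro _ (⟨l, hl, rfl⟩ | ⟨l, hl, rfl⟩) <;> simp at hl ⊢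
    rintro rfl
    rcases hl with hl | hl
    · exact hij hl.symm
    · exact hj hl)
  have h2 := hs.poly.submod (A := {a} ∪ wz ↑(T n)) (B := wz {i}ᶜ) (C := wz ↑(T n))
    Set.subset_union_right (wz_mono (by
      intro l hl; simp; rintro rfl; exact hi (by simpa using hl)))
  have h3 : h ({a} ∪ wz {i}ᶜ) ≤ h ({a} ∪ wz ↑(T n) ∪ wz {i}ᶜ) :=
    hs.poly.mono (Set.union_subset_union_left _ Set.subset_union_left)
  have h4 := hs.poly.submod (A := z '' (insert i R)) (B := z '' ↑(T n)) (C := z '' R)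
    (Set.image_mono (Set.subset_insert _ _)) (Set.image_mono hR)
  have h5 : h (z '' ({i} ∪ ↑(T n))) ≤ h (z '' (insert i R) ∪ z '' ↑(T n)) :=
    hs.poly.mono (by rintro _ ⟨l, hl, rfl⟩; simp at hl ⊢; tauto)
  linarith

theorem explicit_key_gain (hs : IsSecAgg S T L h)
    (hS : ∀ (m : Fin M) (A : Finset (Usr U V)), A ⊆ S m → ∃ m', S m' = A)
    (hT : ∀ (n : Fin N) (A : Finset (Usr U V)), A ⊆ T n → ∃ n', T n' = A)
    {m : Fin M} {n : Fin N} (hn : T n ≠ Finset.univ) {i : Usr U V} (him : i ∈ S m)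
    (hin : i ∈ T n) {R : Finset (Usr U V)} (hiR : i ∉ R) (hR : R ⊆ T n) :
    L + h (z '' ↑R) ≤ h (z '' (insert i ↑R)) := by
  obtain ⟨m', hm'⟩ := hS m {i} (by simpa using him)
  obtain ⟨n', rfl⟩ := hT n R hR
  obtain ⟨j, hj⟩ : ∃ j, j ∉ T n := by
    by_contra! hc
    exact hn (Finset.eq_univ_iff_forall.2 hc)
  refine hs.key_insert_gain (k := i.1) m' n' (a := x i) (Or.inr ⟨i, rfl, rfl⟩) hiR
    (hs.wz_det_x (by simp [wz]) (by simp [wz])) (IsPolymatroid.determines_of_subset (by simp [hm']))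
    (fun hc => hj (hR hc)) (by rintro rfl; exact hj hin) (hs.x_gain i) subset_rfl

end IsSecAgg

section ServerCombinatorics

variable {U : ℕ} {V : Fin U → ℕ}

theorem card_Ksrv (u : Fin U) : (Ksrv U V u).card = V u := by
  have h : Ksrv U V u = Finset.univ.map ⟨Sigma.mk u, sigma_mk_injective⟩ := by
    ext ⟨a, b⟩
    simp only [Ksrv, Finset.mem_filter, Finset.mem_univ, true_and, Finset.mem_map,
      Function.Embedding.coeFn_mk]
    constructor
    · rintro rfl; exact ⟨b, rfl⟩
    · rintro ⟨c, hc⟩; exact (congrArg Sigma.fst hc).symm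
  rw [h, Finset.card_map, Finset.card_univ, Fintype.card_fin]

theorem card_usr : Fintype.card (Usr U V) = Ktot U V := by
  simp [Ktot]

theorem mem_UServers {A B : Finset (Usr U V)} {u : Fin U} :
    u ∈ UServers U V A B ↔
      (∃ i ∈ A, i.1 = u) ∧ ∀ i : Usr U V, i.1 = u → i ∈ A ∪ B := by
  have h : ((A ∪ B) ∩ Ksrv U V u).card = V u ↔ ∀ i : Usr U V, i.1 = u → i ∈ A ∪ B := by
    rw [← card_Ksrv (V := V) u]
    constructor
    · intro h i hi
      have := Finset.eq_of_subset_of_card_le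
        (Finset.inter_subset_right (s₁ := A ∪ B) (s₂ := Ksrv U V u)) h.ge
      have hi' : i ∈ (A ∪ B) ∩ Ksrv U V u := by rw [this]; simp [Ksrv, hi]
      exact (Finset.mem_inter.1 hi').1
    · intro h
      rw [Finset.inter_eq_right.2]
      intro i hi
      exact h i (by simpa [Ksrv] using hi)
  unfold UServers
  rw [Finset.mem_filter, h]
  simp [Finset.Nonempty, Ksrv]

theorem mem_BigB {A B : Finset (Usr U V)} {u : Fin U} {i : Usr U V} :
    i ∈ BigB U V A B u ↔ (i ∈ A ∧ i.1 = u) ∨ i.1 ∈ UServers U V A B ∨ i ∈ B := by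
  simp [BigB, Ksrv, KsrvSet]

theorem BigB_subset (A B : Finset (Usr U V)) (u : Fin U) : BigB U V A B u ⊆ A ∪ B := by
  intro i hi
  rcases mem_BigB.1 hi with h | h | h
  · simp [h.1]
  · exact (mem_UServers.1 h).2 i rfl
  · simp [h]

theorem BigB_eq_univ {A B : Finset (Usr U V)} (u : Fin U) (h : A ∪ B = Finset.univ) :
    BigB U V A B u = Finset.univ := by
  refine Finset.eq_univ_iff_forall.2 fun i => mem_BigB.2 ?_
  have hi : i ∈ A ∪ B := by simp [h]
  rcases Finset.mem_union.1 hi with hi | hi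
  · exact Or.inr (Or.inl (mem_UServers.2 ⟨⟨i, hi, rfl⟩, fun j _ => by simp [h]⟩))
  · exact Or.inr (Or.inr hi)

theorem mem_BigB_of_card {A B : Finset (Usr U V)} {u : Fin U} {i : Usr U V}
    (hc : (BigB U V A B u).card = Ktot U V - 1) (hi : i ∉ BigB U V A B u) {l : Usr U V}
    (hl : l ≠ i) : l ∈ BigB U V A B u := by
  have h : BigB U V A B u = Finset.univ.erase i := by
    refine Finset.eq_of_subset_of_card_le (fun k hk => ?_) ?_
    · simp only [Finset.mem_erase, Finset.mem_univ, and_true]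
      rintro rfl
      exact hi hk
    · rw [hc, Finset.card_erase_of_mem (Finset.mem_univ _), Finset.card_univ, card_usr]
  simp [h, hl]

theorem three_le_Ktot (hU : 3 ≤ U) (hV : ∀ u, 1 ≤ V u) : 3 ≤ Ktot U V := by
  calc 3 ≤ U := hU
    _ = ∑ _u : Fin U, 1 := by simp
    _ ≤ Ktot U V := Finset.sum_le_sum fun u _ => hV u

theorem exists_notMem_ne {B : Finset (Usr U V)} (hK : 3 ≤ Ktot U V)
    (hB : B.card ≤ Ktot U V - 2) (i : Usr U V) : ∃ j, j ∉ B ∧ i ≠ j := by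
  by_contra! hc
  have h1 : Finset.univ ⊆ insert i B := fun j _ => by
    by_cases hj : j ∈ B
    · simp [hj]
    · simp [hc j hj]
  have h2 := (Finset.card_le_card h1).trans (Finset.card_insert_le i B)
  rw [Finset.card_univ, card_usr] at h2
  omega

end ServerCombinatorics

namespace IsSecAgg

variable {U : ℕ} {V : Fin U → ℕ} {M N : ℕ} {S : Fin M → Finset (Usr U V)}
  {T : Fin N → Finset (Usr U V)} {L : ℝ} {h : Set (Var U V) → ℝ}

theorem implicit_key_gain (hs : IsSecAgg S T L h) (hK : 3 ≤ Ktot U V)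
    (hTcard : ∀ n, (T n).card ≤ Ktot U V - 2) {i : Usr U V} (hi : i ∈ SImp U V S T)
    {R : Finset (Usr U V)} (hiR : i ∉ R) (hR : R ⊆ SImp U V S T) :
    L + h (z '' ↑R) ≤ h (z '' (insert i ↑R)) := by
  obtain ⟨hiS, u, m, n, hc, hiB⟩ := (Finset.mem_filter.1 hi).2
  have hiT : i ∉ T n := fun hc' => hiB (mem_BigB.2 (Or.inr (Or.inr hc')))
  have hcover : ∀ l, l ≠ i → l ∈ S m ∪ T n := fun l hl =>
    BigB_subset _ _ u (mem_BigB_of_card hc hiB hl)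
  have hRT : R ⊆ T n := by
    intro l hl
    have hli : l ≠ i := by rintro rfl; exact hiR hl
    have hlS := (Finset.mem_filter.1 (hR hl)).2.1 m
    exact (Finset.mem_union.1 (hcover l hli)).resolve_left hlS
  obtain ⟨j, hj, hij⟩ := exists_notMem_ne hK (hTcard n) i
  have hw : Determines h ({sum} ∪ w '' (↑(S m) ∪ ↑(T n))) {w i} := by
    refine hs.poly.determines_mono (hs.det_w i) (Set.union_subset_union_right _
      (Set.image_mono fun l hl => ?_))
    simpa using hcover l hl
  by_cases hu : i.1 = u
  · exact hs.key_insert_gain (k := u) m n (a := x i) (Or.inr ⟨i, hu, rfl⟩) hiT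
      (hs.wz_det_x (by simp [wz]) (by simp [wz])) hw hj hij (hs.x_gain i) (by simpa using hRT)
  · refine hs.key_insert_gain (k := u) m n (a := y i.1) (Or.inl ⟨i.1, hu, rfl⟩) hiT
      (hs.wz_det_y fun l hl => ?_) hw hj hij (hs.y_gain hu) (by simpa using hRT)
    have : l = i ∨ l ∈ T n := by
      by_contra! hli
      rcases mem_BigB.1 (mem_BigB_of_card hc hiB hli.1) with h' | h' | h'
      · exact hu (hl ▸ h'.2)
      · exact hiB (mem_BigB.2 (Or.inr (Or.inl (hl ▸ h'))))
      · exact hli.2 h'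
    simpa [wz] using this

/-- The keys of a colluding set carry `L` units for each member of the total security input
set. -/
theorem colluding_key_bound (hs : IsSecAgg S T L h) (hK : 3 ≤ Ktot U V)
    (hTcard : ∀ n, (T n).card ≤ Ktot U V - 2)
    (hS : ∀ (m : Fin M) (A : Finset (Usr U V)), A ⊆ S m → ∃ m', S m' = A)
    (hT : ∀ (n : Fin N) (A : Finset (Usr U V)), A ⊆ T n → ∃ n', T n' = A) (n : Fin N) :
    ((T n ∩ Sbar U V S T).card : ℝ) * L ≤ h (z '' ↑(T n)) := by
  set A := T n ∩ SImp U V S T with hA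
  set B := T n ∩ Finset.univ.biUnion fun m => S m with hB
  have hTn : T n ≠ Finset.univ := by
    intro hc
    have := hTcard n
    rw [hc, Finset.card_univ, card_usr] at this
    omega
  have hdisj : Disjoint A B := by
    rw [Finset.disjoint_left]
    intro i hiA hiB
    obtain ⟨m, -, hm⟩ := Finset.mem_biUnion.1 (Finset.mem_inter.1 hiB).2
    exact (Finset.mem_filter.1 (Finset.mem_inter.1 hiA).2).2.1 m hm
  have hA_bound : ∀ R : Finset (Usr U V), R ⊆ A → (R.card : ℝ) * L ≤ h (z '' ↑R) := by
    intro R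
    induction R using Finset.induction_on with
    | empty => simp [hs.poly.empty]
    | @insert i R hi ih =>
      intro hR
      rw [Finset.insert_subset_iff] at hR
      have h1 := hs.implicit_key_gain hK hTcard (Finset.mem_inter.1 hR.1).2 hi
        fun l hl => (Finset.mem_inter.1 (hR.2 hl)).2
      have h2 := ih hR.2
      rw [Finset.card_insert_of_notMem hi, Finset.coe_insert]
      push_cast
      linarith
  have hB_bound : ∀ R : Finset (Usr U V), R ⊆ B →
      (A.card : ℝ) * L + (R.card : ℝ) * L ≤ h (z '' ↑(R ∪ A)) := by
    intro R
    induction R using Finset.induction_on with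
    | empty => simpa using hA_bound A subset_rfl
    | @insert i R hi ih =>
      intro hR
      rw [Finset.insert_subset_iff] at hR
      have hiT := (Finset.mem_inter.1 hR.1).1
      obtain ⟨m, -, hm⟩ := Finset.mem_biUnion.1 (Finset.mem_inter.1 hR.1).2
      have h1 := hs.explicit_key_gain hS hT hTn hm hiT (R := R ∪ A)
        (by
          rw [Finset.mem_union, not_or]
          exact ⟨hi, fun hc => Finset.disjoint_left.1 hdisj hc hR.1⟩)
        (Finset.union_subset (hR.2.trans Finset.inter_subset_left) Finset.inter_subset_left)
      have h2 := ih hR.2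
      rw [Finset.card_insert_of_notMem hi, Finset.insert_union, Finset.coe_insert]
      push_cast at h1 h2 ⊢
      linarith
  have hAB : T n ∩ Sbar U V S T = B ∪ A := Finset.inter_union_distrib_left _ _ _
  rw [hAB, Finset.card_union_of_disjoint hdisj.symm]
  refine le_trans ?_ ((hB_bound B subset_rfl).trans (hs.poly.mono (Set.image_mono ?_)))
  · push_cast; linarith
  · exact_mod_cast Finset.union_subset Finset.inter_subset_left Finset.inter_subset_left

/-- The messages of the secured users of server `k` and of the secured servers carry `L` units
of information each, even given the inputs and keys of the colluding set. -/
theorem messages_gain (hs : IsSecAgg S T L h) (k : Fin U) {A B : Finset (Usr U V)}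
    (hAB : Disjoint A B) :
    h (wz ↑B) + ((A ∩ Ksrv U V k).card + ((UServers U V A B).erase k).card) * L ≤
      h (x '' ↑(A ∩ Ksrv U V k) ∪ y '' ↑((UServers U V A B).erase k) ∪ wz ↑B) := by
  have hx : Function.Injective (x : Usr U V → Var U V) := fun _ _ hij => Var.x.inj hij
  have hy : Function.Injective (y : Fin U → Var U V) := fun _ _ hij => Var.y.inj hij
  have key := hs.poly.add_card_mul_le L (wz ↑B)
    ((A ∩ Ksrv U V k).map ⟨x, hx⟩ ∪ ((UServers U V A B).erase k).map ⟨y, hy⟩) ?_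
  · rw [Finset.card_union_of_disjoint, Finset.card_map, Finset.card_map] at key
    · rw [Finset.coe_union, Finset.coe_map, Finset.coe_map, Nat.cast_add] at key
      exact key
    · rw [Finset.disjoint_left]
      intro v hv hv'
      obtain ⟨i, -, rfl⟩ := Finset.mem_map.1 hv
      obtain ⟨u, -, hu⟩ := Finset.mem_map.1 hv'
      cases hu
  have hsub : ∀ i ∈ A, wz (↑B : Set (Usr U V)) ⊆ wz {i}ᶜ := fun i hi => wz_mono fun l hl => by
    rw [Set.mem_compl_iff, Set.mem_singleton_iff]
    rintro rfl
    exact Finset.disjoint_left.1 hAB hi (Finset.mem_coe.1 hl)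
  have hdx : ∀ i l : Usr U V, l ≠ i → Determines h (wz {i}ᶜ) {x l} := fun i l hl =>
    hs.wz_det_x (by simp [wz, hl]) (by simp [wz, hl])
  have hdy : ∀ (i : Usr U V) (u : Fin U), u ≠ i.1 → Determines h (wz {i}ᶜ) {y u} :=
    fun i u hu => hs.wz_det_y fun l hl => by
      have : l ≠ i := by rintro rfl; exact hu hl.symm
      simp [wz, this]
  intro v hv
  rcases Finset.mem_union.1 hv with hv | hv
  · obtain ⟨i, hi, rfl⟩ := Finset.mem_map.1 hv
    obtain ⟨hiA, hik⟩ := Finset.mem_inter.1 hi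
    have hik' : i.1 = k := by simpa [Ksrv] using hik
    refine ⟨wz {i}ᶜ, hsub i hiA, fun c hc hne => ?_, hs.x_gain i⟩
    rcases Finset.mem_union.1 hc with hc | hc
    · obtain ⟨l, -, rfl⟩ := Finset.mem_map.1 hc
      exact hdx i l (by rintro rfl; exact hne rfl)
    · obtain ⟨u, hu, rfl⟩ := Finset.mem_map.1 hc
      exact hdy i u (by rw [hik']; exact (Finset.mem_erase.1 hu).1)
  · obtain ⟨u, hu, rfl⟩ := Finset.mem_map.1 hv
    obtain ⟨huk, huU⟩ := Finset.mem_erase.1 hu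
    obtain ⟨⟨i, hiA, rfl⟩, -⟩ := mem_UServers.1 huU
    refine ⟨wz {i}ᶜ, hsub i hiA, fun c hc hne => ?_, hs.y_gain huk⟩
    rcases Finset.mem_union.1 hc with hc | hc
    · obtain ⟨l, hl, rfl⟩ := Finset.mem_map.1 hc
      refine hdx i l ?_
      rintro rfl
      exact huk (by simpa [Ksrv] using (Finset.mem_inter.1 hl).2)
    · obtain ⟨u, -, rfl⟩ := Finset.mem_map.1 hc
      exact hdy i u (by rintro rfl; exact hne rfl)

/-- The source key bound for a polymatroid satisfying the constraints of secure aggregation. -/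
theorem source_key_bound (hs : IsSecAgg S T L h) (hK : 3 ≤ Ktot U V)
    (hTcard : ∀ n, (T n).card ≤ Ktot U V - 2)
    (hS : ∀ (m : Fin M) (A : Finset (Usr U V)), A ⊆ S m → ∃ m', S m' = A)
    (hT : ∀ (n : Fin N) (A : Finset (Usr U V)), A ⊆ T n → ∃ n', T n' = A)
    (k : Fin U) (m : Fin M) (n : Fin N) (hdisj : S m ∩ T n = ∅)
    (hcard : (BigB U V (S m) (T n) k).card ≤ Ktot U V - 1) :
    ((((S m ∩ Ksrv U V k) ∪ T n) ∩ Sbar U V S T).card +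
      ((UServers U V (S m) (T n)).erase k).card : ℝ) * L ≤ h {source} := by
  have hdisj' : Disjoint (S m) (T n) := Finset.disjoint_iff_inter_eq_empty.2 hdisj
  obtain ⟨j, hj⟩ : ∃ j, j ∉ S m ∪ T n := by
    by_contra! hc
    rw [BigB_eq_univ k (Finset.eq_univ_iff_forall.2 hc), Finset.card_univ, card_usr] at hcard
    omega
  rw [Finset.mem_union, not_or] at hj
  have hmsg : ∀ C : Set (Var U V), (∀ i ∈ S m ∪ T n, w i ∈ C ∧ z i ∈ C) → Determines h C
      (x '' ↑(S m ∩ Ksrv U V k) ∪ y '' ↑((UServers U V (S m) (T n)).erase k)) := by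
    intro C hC
    refine hs.poly.determines_of_finite (Set.toFinite _) ?_
    rintro _ (⟨i, hi, rfl⟩ | ⟨u, hu, rfl⟩)
    · have hi' := hC i (Finset.mem_union_left _ (Finset.mem_inter.1 (Finset.mem_coe.1 hi)).1)
      exact hs.wz_det_x hi'.1 hi'.2
    · refine hs.wz_det_y fun i hi => hC i ?_
      exact (mem_UServers.1 (Finset.mem_erase.1 (Finset.mem_coe.1 hu)).2).2 i hi
  have h1 := hs.key_gain (k := k) m n
    (a := x '' ↑(S m ∩ Ksrv U V k) ∪ y '' ↑((UServers U V (S m) (T n)).erase k))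
    (by
      rintro _ (⟨i, hi, rfl⟩ | ⟨u, hu, rfl⟩)
      · exact Or.inr ⟨i, by simpa [Ksrv] using (Finset.mem_inter.1 (Finset.mem_coe.1 hi)).2, rfl⟩
      · exact Or.inl ⟨u, (Finset.mem_erase.1 (Finset.mem_coe.1 hu)).1, rfl⟩)
    Set.univ (hmsg _ fun i hi => by simpa using hi) hj.2
    (hmsg _ fun i hi => by
      simp only [Set.image_univ, Set.mem_union, Set.mem_image, Set.mem_compl_iff,
        Set.mem_singleton_iff]
      refine ⟨Or.inl ⟨i, ?_, rfl⟩, Or.inr ⟨i, rfl⟩⟩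
      rintro rfl
      simp [hj] at hi)
  have h2 := hs.messages_gain k hdisj'
  have h3 := hs.colluding_key_bound hK hTcard hS hT n
  have h4 := hs.poly.le_of_determines hs.det_z
  rw [Set.univ_union] at h1
  have h5 : ((S m ∩ Ksrv U V k) ∪ T n) ∩ Sbar U V S T =
      (S m ∩ Ksrv U V k) ∪ (T n ∩ Sbar U V S T) := by
    rw [Finset.union_inter_distrib_right]
    congr 1
    refine Finset.inter_eq_left.2 fun i hi => ?_
    exact Finset.mem_union_left _ (Finset.mem_biUnion.2 ⟨m, Finset.mem_univ _,
      (Finset.mem_inter.1 hi).1⟩)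
  have h6 : Disjoint (S m ∩ Ksrv U V k) (T n ∩ Sbar U V S T) :=
    hdisj'.mono Finset.inter_subset_left Finset.inter_subset_left
  rw [h5, Finset.card_union_of_disjoint h6]
  push_cast
  linarith

end IsSecAgg

/-! ### The entropy of a finite partition -/

section PartitionEntropy

variable {Ω : Type} [Fintype Ω]

/-- The weight of the class of `ω`. -/
noncomputable def classMass (μ : Ω → ℝ) (r : Setoid Ω) (ω : Ω) : ℝ :=
  ∑ a, if r a ω then μ a else 0

/-- The entropy of the partition into classes of `r`. -/
noncomputable def relEnt (q : ℕ) (μ : Ω → ℝ) (r : Setoid Ω) : ℝ :=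
  -∑ ω, μ ω * Real.logb q (classMass μ r ω)

theorem prb_apply (μ : Ω → ℝ) {α : Type} (X : Ω → α) (ω : Ω) :
    prb μ X (X ω) = classMass μ (Setoid.ker X) ω := by
  simp only [prb, classMass, Setoid.ker_def, Finset.sum_filter]

theorem sum_prb_mul (μ : Ω → ℝ) {α : Type} [Fintype α] (X : Ω → α) (g : α → ℝ) :
    ∑ s, prb μ X s * g s = ∑ ω, μ ω * g (X ω) := by
  rw [← Finset.sum_fiberwise Finset.univ X]
  refine Finset.sum_congr rfl fun s _ => ?_
  rw [prb, Finset.sum_mul]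
  refine Finset.sum_congr (by ext; simp) fun ω hω => ?_
  rw [(Finset.mem_filter.1 hω).2]

theorem ent_eq_relEnt (q : ℕ) (μ : Ω → ℝ) {α : Type} [Fintype α] (X : Ω → α) :
    ent q μ X = relEnt q μ (Setoid.ker X) := by
  rw [ent, relEnt, sum_prb_mul μ X fun s => Real.logb q (prb μ X s)]
  simp only [prb_apply]

theorem classMass_congr (μ : Ω → ℝ) {r : Setoid Ω} {a b : Ω} (hab : r a b) :
    classMass μ r a = classMass μ r b := by
  unfold classMass
  refine Finset.sum_congr rfl fun c _ => ?_
  have : r c a ↔ r c b := ⟨fun h => r.trans h hab, fun h => r.trans h (r.symm hab)⟩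
  simp only [this]

theorem relEnt_top (q : ℕ) {μ : Ω → ℝ} (h1 : ∑ ω, μ ω = 1) : relEnt q μ ⊤ = 0 := by
  have h : ∀ ω, classMass μ ⊤ ω = 1 := fun ω => by
    simp [classMass, Setoid.top_def, h1]
  simp [relEnt, h]

variable {μ : Ω → ℝ}

theorem classMass_nonneg (hμ : ∀ ω, 0 ≤ μ ω) (r : Setoid Ω) (ω : Ω) : 0 ≤ classMass μ r ω :=
  Finset.sum_nonneg fun a _ => by split_ifs <;> simp [hμ]

theorem classMass_mono (hμ : ∀ ω, 0 ≤ μ ω) {r r' : Setoid Ω} (h : r ≤ r') (ω : Ω) :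
    classMass μ r ω ≤ classMass μ r' ω := by
  refine Finset.sum_le_sum fun a _ => ?_
  by_cases ha : r a ω
  · simp [ha, h ha]
  · simp only [ha, if_false]
    split_ifs <;> simp [hμ]

theorem le_classMass (hμ : ∀ ω, 0 ≤ μ ω) (r : Setoid Ω) (ω : Ω) : μ ω ≤ classMass μ r ω := by
  have h := Finset.single_le_sum (f := fun a => if r a ω then μ a else 0)
    (fun a _ => by split_ifs <;> simp [hμ]) (Finset.mem_univ ω)
  rwa [if_pos (r.refl ω)] at h

theorem relEnt_anti (hμ : ∀ ω, 0 ≤ μ ω) {q : ℕ} (hq : 1 < q) {r r' : Setoid Ω} (h : r ≤ r') :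
    relEnt q μ r' ≤ relEnt q μ r := by
  refine neg_le_neg (Finset.sum_le_sum fun ω _ => ?_)
  rcases (hμ ω).eq_or_lt with h0 | h0
  · simp [← h0]
  · exact mul_le_mul_of_nonneg_left (Real.logb_le_logb_of_le (by exact_mod_cast hq)
      (h0.trans_le (le_classMass hμ r ω)) (classMass_mono hμ h ω)) h0.le

theorem sum_ratio_le_one (hμ : ∀ ω, 0 ≤ μ ω) (h1 : ∑ ω, μ ω = 1) {r₁ r₂ r₃ : Setoid Ω}
    (h₁ : r₁ ≤ r₃)
    (h₂ : r₂ ≤ r₃) :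
    ∑ ω, μ ω * (classMass μ r₁ ω * classMass μ r₂ ω /
      (classMass μ (r₁ ⊓ r₂) ω * classMass μ r₃ ω)) ≤ 1 := by
  have expand : ∀ ω, μ ω * (classMass μ r₁ ω * classMass μ r₂ ω /
      (classMass μ (r₁ ⊓ r₂) ω * classMass μ r₃ ω)) =
      ∑ a, ∑ b, μ a * μ b * (if r₁ a ω ∧ r₂ b ω then
        μ ω / (classMass μ (r₁ ⊓ r₂) ω * classMass μ r₃ ω) else 0) := fun ω => by
    rw [show μ ω * (classMass μ r₁ ω * classMass μ r₂ ω /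
      (classMass μ (r₁ ⊓ r₂) ω * classMass μ r₃ ω)) = classMass μ r₁ ω * classMass μ r₂ ω *
      (μ ω / (classMass μ (r₁ ⊓ r₂) ω * classMass μ r₃ ω)) by ring]
    generalize μ ω / (classMass μ (r₁ ⊓ r₂) ω * classMass μ r₃ ω) = c
    simp only [classMass]
    rw [Finset.sum_mul_sum, Finset.sum_mul]
    refine Finset.sum_congr rfl fun a _ => ?_
    rw [Finset.sum_mul]
    refine Finset.sum_congr rfl fun b _ => ?_
    by_cases ha : r₁ a ω <;> by_cases hb : r₂ b ω <;> simp [ha, hb]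
  have inner : ∀ a b, (∑ ω, if r₁ a ω ∧ r₂ b ω then
      μ ω / (classMass μ (r₁ ⊓ r₂) ω * classMass μ r₃ ω) else 0) ≤
      if r₃ b a then (classMass μ r₃ a)⁻¹ else 0 := by
    intro a b
    by_cases hex : ∃ c, r₁ a c ∧ r₂ b c
    · obtain ⟨c, hac, hbc⟩ := hex
      rw [if_pos (r₃.trans (h₂ hbc) (r₃.symm (h₁ hac)))]
      have hsum : (∑ ω, if r₁ a ω ∧ r₂ b ω then
          μ ω / (classMass μ (r₁ ⊓ r₂) ω * classMass μ r₃ ω) else 0) =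
          classMass μ (r₁ ⊓ r₂) c / (classMass μ (r₁ ⊓ r₂) c * classMass μ r₃ a) := by
        generalize hd : classMass μ (r₁ ⊓ r₂) c * classMass μ r₃ a = d
        rw [classMass, Finset.sum_div]
        refine Finset.sum_congr rfl fun ω _ => ?_
        have hiff : (r₁ a ω ∧ r₂ b ω) ↔ (r₁ ⊓ r₂) ω c := by
          exact ⟨fun h => ⟨r₁.trans (r₁.symm h.1) hac, r₂.trans (r₂.symm h.2) hbc⟩,
            fun h => ⟨r₁.trans hac (r₁.symm h.1), r₂.trans hbc (r₂.symm h.2)⟩⟩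
        by_cases hω : (r₁ ⊓ r₂) ω c
        · rw [if_pos (hiff.2 hω), if_pos hω, classMass_congr μ hω,
            classMass_congr μ (r₃.symm (h₁ (hiff.2 hω).1)), hd]
        · rw [if_neg (mt hiff.1 hω), if_neg hω, zero_div]
      rw [hsum, ← div_div, div_eq_mul_inv _ (classMass μ r₃ a)]
      exact mul_le_of_le_one_left (inv_nonneg.2 (classMass_nonneg hμ _ _)) (div_self_le_one _)
    · rw [Finset.sum_eq_zero fun ω _ => if_neg fun h => hex ⟨ω, h⟩]
      split_ifs
      · exact inv_nonneg.2 (classMass_nonneg hμ _ _)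
      · exact le_rfl
  calc _ = ∑ a, ∑ b, μ a * μ b * ∑ ω, (if r₁ a ω ∧ r₂ b ω then
        μ ω / (classMass μ (r₁ ⊓ r₂) ω * classMass μ r₃ ω) else 0) := by
        simp only [expand, Finset.mul_sum]
        rw [Finset.sum_comm]
        exact Finset.sum_congr rfl fun a _ => Finset.sum_comm
    _ ≤ ∑ a, ∑ b, μ a * μ b * (if r₃ b a then (classMass μ r₃ a)⁻¹ else 0) :=
        Finset.sum_le_sum fun a _ => Finset.sum_le_sum fun b _ =>
          mul_le_mul_of_nonneg_left (inner a b) (mul_nonneg (hμ a) (hμ b))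
    _ = ∑ a, μ a * (classMass μ r₃ a / classMass μ r₃ a) := by
        refine Finset.sum_congr rfl fun a _ => ?_
        rw [div_eq_mul_inv]
        conv_rhs => rw [classMass]
        rw [Finset.sum_mul, Finset.mul_sum]
        refine Finset.sum_congr rfl fun b _ => ?_
        by_cases hb : r₃ b a
        · simp only [hb, if_true]; rw [mul_assoc]; rfl
        · simp [hb]
    _ ≤ ∑ a, μ a := Finset.sum_le_sum fun a _ =>
        mul_le_of_le_one_right (hμ a) (div_self_le_one _)
    _ = 1 := h1

theorem relEnt_submod (hμ : ∀ ω, 0 ≤ μ ω) {q : ℕ} (hq : 1 < q) (h1 : ∑ ω, μ ω = 1)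
    {r₁ r₂ r₃ : Setoid Ω}
    (h₁ : r₁ ≤ r₃) (h₂ : r₂ ≤ r₃) :
    relEnt q μ (r₁ ⊓ r₂) + relEnt q μ r₃ ≤ relEnt q μ r₁ + relEnt q μ r₂ := by
  have hlog : 0 < Real.log q := Real.log_pos (by exact_mod_cast hq)
  have term : ∀ ω, μ ω * Real.logb q (classMass μ r₁ ω) + μ ω * Real.logb q (classMass μ r₂ ω) -
      μ ω * Real.logb q (classMass μ (r₁ ⊓ r₂) ω) - μ ω * Real.logb q (classMass μ r₃ ω) ≤
      (μ ω * (classMass μ r₁ ω * classMass μ r₂ ω /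
        (classMass μ (r₁ ⊓ r₂) ω * classMass μ r₃ ω)) - μ ω) / Real.log q := by
    intro ω
    rcases (hμ ω).eq_or_lt with h0 | h0
    · simp [← h0]
    have p₁ := h0.trans_le (le_classMass hμ r₁ ω)
    have p₂ := h0.trans_le (le_classMass hμ r₂ ω)
    have p₁₂ := h0.trans_le (le_classMass hμ (r₁ ⊓ r₂) ω)
    have p₃ := h0.trans_le (le_classMass hμ r₃ ω)
    have hle := Real.log_le_sub_one_of_pos (div_pos (mul_pos p₁ p₂) (mul_pos p₁₂ p₃))
    rw [Real.log_div (mul_pos p₁ p₂).ne' (mul_pos p₁₂ p₃).ne', Real.log_mul p₁.ne' p₂.ne',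
      Real.log_mul p₁₂.ne' p₃.ne'] at hle
    rw [le_div_iff₀ hlog]
    simp only [Real.logb]
    have := mul_le_mul_of_nonneg_left hle h0.le
    field_simp at this ⊢
    linarith
  have hsum := Finset.sum_le_sum fun ω (_ : ω ∈ Finset.univ) => term ω
  rw [← Finset.sum_div, Finset.sum_sub_distrib, Finset.sum_sub_distrib, Finset.sum_sub_distrib,
    Finset.sum_add_distrib, h1] at hsum
  have hle : (∑ ω, μ ω * (classMass μ r₁ ω * classMass μ r₂ ω /
      (classMass μ (r₁ ⊓ r₂) ω * classMass μ r₃ ω)) - 1) / Real.log q ≤ 0 :=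
    div_nonpos_of_nonpos_of_nonneg (sub_nonpos.2 (sum_ratio_le_one hμ h1 h₁ h₂)) hlog.le
  unfold relEnt
  linarith

/-- The uniform distribution maximizes the entropy. -/
theorem ent_le_logb_card (hμ : ∀ ω, 0 ≤ μ ω) {q : ℕ} (hq : 1 < q) (h1 : ∑ ω, μ ω = 1)
    {α : Type} [Fintype α]
    [Nonempty α] (X : Ω → α) : ent q μ X ≤ Real.logb q (Fintype.card α) := by
  have hlog : 0 < Real.log q := Real.log_pos (by exact_mod_cast hq)
  have hN : (0 : ℝ) < Fintype.card α := by exact_mod_cast Fintype.card_pos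
  have hnn : ∀ s, 0 ≤ prb μ X s := fun s => Finset.sum_nonneg fun ω _ => hμ ω
  have hone : ∑ s, prb μ X s = 1 := by
    simpa [h1] using sum_prb_mul μ X fun _ => 1
  have term : ∀ s, -(prb μ X s * Real.logb q (prb μ X s)) -
      prb μ X s * Real.logb q (Fintype.card α) ≤
      ((Fintype.card α : ℝ)⁻¹ - prb μ X s) / Real.log q := by
    intro s
    rcases (hnn s).eq_or_lt with h0 | h0
    · rw [← h0]; simp; positivity
    have hle := Real.log_le_sub_one_of_pos (inv_pos.2 (mul_pos h0 hN))
    rw [Real.log_inv, Real.log_mul h0.ne' hN.ne'] at hle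
    rw [le_div_iff₀ hlog]
    simp only [Real.logb]
    have := mul_le_mul_of_nonneg_left hle h0.le
    field_simp at this ⊢
    linarith
  have hsum := Finset.sum_le_sum fun s (_ : s ∈ Finset.univ) => term s
  rw [← Finset.sum_div, Finset.sum_sub_distrib, Finset.sum_sub_distrib, Finset.sum_neg_distrib,
    ← Finset.sum_mul, hone] at hsum
  simp [hN.ne'] at hsum
  unfold ent
  linarith

end PartitionEntropy

section JointEntropy

variable {Ω J : Type}

/-- The joint entropy of a set of random variables, each given by the partition it induces. -/
noncomputable def jointEnt [Fintype Ω] (q : ℕ) (μ : Ω → ℝ) (r : J → Setoid Ω) (A : Set J) : ℝ :=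
  relEnt q μ (⨅ v ∈ A, r v)

theorem isPolymatroid_jointEnt [Fintype Ω] {q : ℕ} (hq : 1 < q) {μ : Ω → ℝ} (hμ : ∀ ω, 0 ≤ μ ω)
    (h1 : ∑ ω, μ ω = 1) (r : J → Setoid Ω) : IsPolymatroid (jointEnt q μ r) where
  empty := by simp [jointEnt, relEnt_top q h1]
  mono hAB := relEnt_anti hμ hq (biInf_mono hAB)
  submod hA hB := by
    unfold jointEnt
    rw [_root_.iInf_union]
    exact relEnt_submod hμ hq h1 (biInf_mono hA) (biInf_mono hB)

theorem ker_prodMk {α β : Type} (X : Ω → α) (Y : Ω → β) :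
    Setoid.ker (fun ω => (X ω, Y ω)) = Setoid.ker X ⊓ Setoid.ker Y := by
  ext a b
  simp [Setoid.ker_def, Setoid.inf_def]

theorem setoid_iInf_apply {ι : Sort*} (r : ι → Setoid Ω) (a b : Ω) :
    (⨅ i, r i) a b ↔ ∀ i, r i a b :=
  Set.forall_mem_range (f := r) (p := fun s => s a b)

theorem ker_restr {ι α : Type} (X : ι → Ω → α) (A : Finset ι) :
    Setoid.ker (restr X A) = ⨅ i ∈ A, Setoid.ker (X i) := by
  ext a b
  simp [Setoid.ker_def, restr, funext_iff, setoid_iInf_apply]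

end JointEntropy

/-- The partition of the sample space induced by each variable of an aggregation scheme. -/
def Var.rel {U : ℕ} {V : Fin U → ℕ} {F Ω : Type} [Field F] {L LX LY LZ LSig : ℕ}
    (W : Usr U V → Ω → Fin L → F) (Z : Usr U V → Ω → Fin LZ → F)
    (X : Usr U V → Ω → Fin LX → F) (Y : Fin U → Ω → Fin LY → F)
    (ZS : Ω → Fin LSig → F) : Var U V → Setoid Ω
  | .w i => Setoid.ker (W i)
  | .z i => Setoid.ker (Z i)
  | .x i => Setoid.ker (X i)
  | .y u => Setoid.ker (Y u)
  | .sum => Setoid.ker fun ω => ∑ i, W i ω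
  | .source => Setoid.ker ZS

theorem IsScheme.isSecAgg {U : ℕ} {V : Fin U → ℕ} {M N : ℕ} {S : Fin M → Finset (Usr U V)}
    {T : Fin N → Finset (Usr U V)} {F : Type} [Field F] [Fintype F] {Ω : Type} [Fintype Ω]
    {μ : Ω → ℝ} {L LX LY LZ LSig : ℕ} {W : Usr U V → Ω → Fin L → F}
    {Z : Usr U V → Ω → Fin LZ → F} {X : Usr U V → Ω → Fin LX → F}
    {Y : Fin U → Ω → Fin LY → F} {ZS : Ω → Fin LSig → F}
    (hs : IsScheme U V M N S T F Ω μ L LX LY LZ LSig W Z X Y ZS) :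
    IsSecAgg S T L (jointEnt (Fintype.card F) μ (Var.rel W Z X Y ZS)) := by
  obtain ⟨-, hμ, h1, hW, hind, -, hZ, hX, hY, hcorr, hsec⟩ := hs
  have hq : 1 < Fintype.card F := Fintype.one_lt_card
  simp only [condEnt, mutInfo, ent_eq_relEnt, ker_prodMk, ker_restr] at hind hZ hX hY hcorr hsec
  have hview : ∀ k : Fin U, ⨅ v ∈ view k, Var.rel W Z X Y ZS v =
      (⨅ u ∈ Finset.univ.erase k, Setoid.ker (Y u)) ⊓
        ⨅ i ∈ Ksrv U V k, Setoid.ker (X i) := fun k => by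
    simp only [view, _root_.iInf_union, iInf_image, Var.rel]
    simp [Ksrv]
  refine
    { poly := isPolymatroid_jointEnt hq hμ h1 _
      w_le := fun i => ?_
      sum_le := ?_
      indep := ?_
      det_z := ?_
      det_x := fun i => ?_
      det_y := fun u => ?_
      det_w := fun j => ?_
      det_sum := fun k => ?_
      secure := fun k m n => ?_ }
  · have := hW i
    rw [ent_eq_relEnt] at this
    simp [jointEnt, Var.rel, this]
  · have := ent_le_logb_card hμ hq h1 fun ω => ∑ i, W i ω
    rw [ent_eq_relEnt] at this
    refine le_trans (by simp [jointEnt, Var.rel]) (this.trans_eq ?_)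
    rw [Fintype.card_fun, Fintype.card_fin, Nat.cast_pow, Real.logb_pow,
      Real.logb_self_eq_one (by exact_mod_cast hq), mul_one]
  · simp only [jointEnt, _root_.iInf_union, iInf_image, Var.rel]
    simp only [Finset.mem_univ, ← ent_eq_relEnt, hW] at hind
    simp only [Finset.sum_const, Finset.card_univ, nsmul_eq_mul] at hind
    simpa using hind.ge
  · have := sub_eq_zero.1 hZ
    rw [inf_comm] at this
    simp only [Determines, jointEnt, _root_.iInf_union, iInf_image, _root_.iInf_singleton, Var.rel]
    simpa using this.le
  · have := sub_eq_zero.1 (hX i)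
    rw [inf_comm] at this
    simp only [Determines, jointEnt, _root_.iInf_union, _root_.iInf_insert, _root_.iInf_singleton, Var.rel]
    exact this.le
  · have := sub_eq_zero.1 (hY u)
    rw [inf_comm] at this
    simp only [Determines, jointEnt, _root_.iInf_union, iInf_image, _root_.iInf_singleton, Var.rel]
    simpa [Ksrv] using this.le
  · have hle : ⨅ v ∈ ({sum} ∪ w '' {j}ᶜ : Set (Var U V)), Var.rel W Z X Y ZS v ≤
        Setoid.ker (W j) := by
      simp only [_root_.iInf_union, iInf_image, _root_.iInf_singleton, Var.rel]
      intro a b hab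
      have hsum : ∑ i, W i a = ∑ i, W i b := hab.1
      have hw : ∀ i ≠ j, W i a = W i b := by
        simpa [setoid_iInf_apply, Setoid.ker_def] using hab.2
      rw [← Finset.add_sum_erase _ _ (Finset.mem_univ j),
        ← Finset.add_sum_erase _ (fun i => W i b) (Finset.mem_univ j),
        Finset.sum_congr rfl fun i hi => hw i (Finset.ne_of_mem_erase hi)] at hsum
      exact add_right_cancel hsum
    unfold Determines jointEnt
    rw [_root_.iInf_union (s := {sum} ∪ w '' {j}ᶜ), _root_.iInf_singleton]
    exact (congrArg _ (inf_eq_left.2 hle)).le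
  · have := sub_eq_zero.1 (hcorr k)
    rw [inf_comm] at this
    unfold Determines jointEnt
    rw [_root_.iInf_union, hview, _root_.iInf_singleton]
    exact this.le
  · have := hsec k m n
    simp only [jointEnt, _root_.iInf_union, hview]
    simp only [wz, _root_.iInf_union, iInf_image, _root_.iInf_singleton, Var.rel, Finset.mem_coe]
    linarith

theorem stmt15_source_key_bound
    (U : ℕ) (hU : 3 ≤ U) (V : Fin U → ℕ) (hV : ∀ u, 1 ≤ V u)
    (M N : ℕ) (S : Fin M → Finset (Usr U V)) (T : Fin N → Finset (Usr U V))
    (hSmono : ∀ (m : Fin M) (A : Finset (Usr U V)), A ⊆ S m → ∃ m', S m' = A)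
    (hTmono : ∀ (n : Fin N) (A : Finset (Usr U V)), A ⊆ T n → ∃ n', T n' = A)
    (hSne : (Finset.univ.biUnion fun m => S m).Nonempty)
    (hTcard : ∀ n, (T n).card ≤ Ktot U V - 2)
    (F : Type) [Field F] [Fintype F] (Ω : Type) [Fintype Ω] (μ : Ω → ℝ)
    (L LX LY LZ LSig : ℕ)
    (W : Usr U V → Ω → Fin L → F) (Z : Usr U V → Ω → Fin LZ → F)
    (X : Usr U V → Ω → Fin LX → F) (Y : Fin U → Ω → Fin LY → F)
    (ZS : Ω → Fin LSig → F)
    (hScheme : IsScheme U V M N S T F Ω μ L LX LY LZ LSig W Z X Y ZS)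
    (u' : Fin U) (m : Fin M) (n : Fin N)
    (hdisj : S m ∩ T n = ∅)
    (hcard : (BigB U V (S m) (T n) u').card ≤ Ktot U V - 1) :
    (((((S m ∩ Ksrv U V u') ∪ T n) ∩ Sbar U V S T).card : ℝ) +
        (((UServers U V (S m) (T n)).erase u').card : ℝ)) * L ≤
      ent (Fintype.card F) μ ZS := by
  have h := hScheme.isSecAgg.source_key_bound (three_le_Ktot hU hV) hTcard hSmono hTmono u' m n
    hdisj hcard
  rw [ent_eq_relEnt]
  simpa [jointEnt, Var.rel] using h
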